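/- Assume the Riemann hypothesis. Then for every δ > 0 there exist constants C > 0 and T₀ ≥ 16 such that for all T ≥ T₀, ∫_T^{T+δ} |ζ(1+it)|^{−1} dt ≤ C · log log log T. -/

import Mathlib

open Complex Real Filter MeasureTheory intervalIntegral

/-- The fractional part of `t` for `t > 1`, and `0` otherwise. -/
noncomputable def fractTail : ℝ → ℂ :=
  (Set.Ioi (1 : ℝ)).indicator fun t ↦ ((Int.fract t : ℝ) : ℂ)

lemma measurable_fractTail : Measurable fractTail :=
  (measurable_ofReal.comp measurable_fract).indicator measurableSet_Ioi

lemma norm_fractTail_le (t : ℝ) : ‖fractTail t‖ ≤ 1 := by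
  unfold fractTail
  by_cases h : t ∈ Set.Ioi (1 : ℝ)
  · rw [Set.indicator_of_mem h, Complex.norm_real, Real.norm_of_nonneg (Int.fract_nonneg t)]
    exact (Int.fract_lt_one t).le
  · simp [Set.indicator_of_notMem h]

lemma differentiableAt_mellin_fractTail {s : ℂ} (hs : s.re < 0) :
    DifferentiableAt ℂ (mellin fractTail) s := by
  refine mellin_differentiableAt_of_isBigO_rpow (a := 0) (b := s.re - 1) ?_ ?_ hs ?_ (by linarith)
  · refine LocallyIntegrable.locallyIntegrableOn ?_ _
    refine (locallyIntegrable_const (1 : ℝ)).mono measurable_fractTail.aestronglyMeasurable ?_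
    exact .of_forall fun t ↦ by simpa using norm_fractTail_le t
  · refine Asymptotics.IsBigO.of_bound 1 (.of_forall fun t ↦ ?_)
    simpa using norm_fractTail_le t
  · refine Asymptotics.IsBigO.of_bound 1 ?_
    have : Set.Iio (1 : ℝ) ∈ nhdsWithin (0 : ℝ) (Set.Ioi 0) :=
      mem_nhdsWithin_of_mem_nhds (Iio_mem_nhds one_pos)
    filter_upwards [this] with t ht
    rw [fractTail, Set.indicator_of_notMem (by simpa using (Set.mem_Iio.mp ht).le)]
    simp

lemma mellin_fractTail (s : ℂ) :
    mellin fractTail (-s) = ∫ t in Set.Ioi (1 : ℝ), ((Int.fract t : ℝ) : ℂ) * t ^ (-(s + 1)) := by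
  have h : ∀ t : ℝ, (t : ℂ) ^ (-s - 1) • fractTail t =
      (Set.Ioi (1 : ℝ)).indicator (fun t : ℝ ↦ ((Int.fract t : ℝ) : ℂ) * t ^ (-(s + 1))) t := by
    intro t
    rw [fractTail]
    by_cases ht : t ∈ Set.Ioi (1 : ℝ)
    · rw [Set.indicator_of_mem ht, Set.indicator_of_mem ht, smul_eq_mul, mul_comm, neg_add,
        sub_eq_add_neg]
    · simp [Set.indicator_of_notMem ht]
  simp_rw [mellin, h]
  rw [setIntegral_indicator measurableSet_Ioi]
  congr 2
  ext t
  simp only [Set.mem_inter_iff, Set.mem_Ioi]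
  constructor
  · exact fun h ↦ h.2
  · exact fun h ↦ ⟨by linarith, h⟩

lemma norm_mellin_fractTail_le {s : ℂ} (hs : 1 / 2 ≤ s.re) : ‖mellin fractTail (-s)‖ ≤ 2 := by
  rw [mellin_fractTail]
  calc _ ≤ ∫ t in Set.Ioi (1 : ℝ), t ^ (-(s.re + 1)) := by
        refine norm_integral_le_of_norm_le (integrableOn_Ioi_rpow_of_lt (by linarith) one_pos) ?_
        filter_upwards [ae_restrict_mem measurableSet_Ioi] with t ht
        have ht' : (0 : ℝ) < t := one_pos.trans ht
        rw [norm_mul, norm_cpow_eq_rpow_re_of_pos ht', Complex.norm_real,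
          Real.norm_of_nonneg (Int.fract_nonneg t)]
        simpa using mul_le_of_le_one_left (Real.rpow_nonneg ht'.le _) (Int.fract_lt_one t).le
    _ ≤ 2 := by
        rw [integral_Ioi_rpow_of_lt (by linarith) one_pos, Real.one_rpow,
          show -1 / (-(s.re + 1) + 1) = 1 / s.re by rw [neg_add_rev]; ring_nf]
        rw [div_le_iff₀ (by linarith)]
        linarith

lemma riemannZeta_eq_mellin_fractTail_of_one_lt_re {s : ℂ} (hs : 1 < s.re) :
    (s - 1) * riemannZeta s = s - s * (s - 1) * mellin fractTail (-s) := by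
  have hs1 : s - 1 ≠ 0 := by
    intro h
    have := congrArg Complex.re h
    simp at this
    linarith
  have hO : (fun n : ℕ ↦ ∑ k ∈ Finset.Icc 1 n, ((1 : ℕ → ℝ) k)) =O[atTop]
      fun n ↦ (n : ℝ) ^ (1 : ℝ) := by
    refine Asymptotics.IsBigO.of_bound 1 (.of_forall fun n ↦ ?_)
    simp
  have h1 := LSeries_eq_mul_integral_of_nonneg (1 : ℕ → ℝ) zero_le_one hs hO (by simp)
  have h2 : LSeries (fun n ↦ (((1 : ℕ → ℝ) n : ℝ) : ℂ)) s = riemannZeta s := by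
    rw [← LSeries_one_eq_riemannZeta hs]
    congr 1
  rw [h2] at h1
  have hi1 : IntegrableOn (fun t : ℝ ↦ (t : ℂ) ^ (-s)) (Set.Ioi 1) :=
    integrableOn_Ioi_cpow_of_lt (by simpa using hs) one_pos
  have hi2 : IntegrableOn (fun t : ℝ ↦ ((Int.fract t : ℝ) : ℂ) * (t : ℂ) ^ (-(s + 1)))
      (Set.Ioi 1) := by
    refine Integrable.bdd_mul (c := 1) (integrableOn_Ioi_cpow_of_lt (by simp; linarith) one_pos)
      (measurable_ofReal.comp measurable_fract).aestronglyMeasurable (.of_forall fun t ↦ ?_)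
    simp [abs_of_nonneg (Int.fract_nonneg t), (Int.fract_lt_one t).le]
  have h3 : ∫ t in Set.Ioi (1 : ℝ), (∑ k ∈ Finset.Icc 1 ⌊t⌋₊, (((1 : ℕ → ℝ) k : ℝ) : ℂ)) *
      (t : ℂ) ^ (-(s + 1)) = ∫ t in Set.Ioi (1 : ℝ), ((t : ℂ) ^ (-s) -
        ((Int.fract t : ℝ) : ℂ) * (t : ℂ) ^ (-(s + 1))) := by
    refine setIntegral_congr_fun measurableSet_Ioi fun t ht ↦ ?_
    have ht' : (0 : ℝ) < t := one_pos.trans ht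
    have e : (t : ℂ) ^ (-s) = t * (t : ℂ) ^ (-(s + 1)) := by
      rw [neg_add, cpow_add _ _ (by exact_mod_cast ht'.ne'), cpow_neg_one]
      field_simp [(by exact_mod_cast ht'.ne' : (t : ℂ) ≠ 0)]
    have e2 : ((⌊t⌋₊ : ℝ) : ℂ) = ((t - Int.fract t : ℝ) : ℂ) := by
      rw [Int.self_sub_fract, natCast_floor_eq_intCast_floor ht'.le]
    simp only [Pi.one_apply, ofReal_one, Finset.sum_const, Nat.card_Icc, nsmul_eq_mul, mul_one,
      add_tsub_cancel_right]
    rw [e, ← sub_mul, ← ofReal_sub, ← e2]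
    simp
  rw [h3, integral_sub hi1 hi2, integral_Ioi_cpow_of_lt (by simpa using hs) one_pos,
    ← mellin_fractTail] at h1
  rw [h1]
  have : -s + 1 ≠ 0 := by rwa [neg_add_eq_sub, ← neg_sub, neg_ne_zero]
  simp
  field_simp
  ring

lemma riemannZeta_eq_mellin_fractTail {s : ℂ} (hs : 0 < s.re) (hs1 : s ≠ 1) :
    (s - 1) * riemannZeta s = s - s * (s - 1) * mellin fractTail (-s) := by
  have hU : IsOpen {z : ℂ | 0 < z.re} := isOpen_lt continuous_const Complex.continuous_re
  have hF := (DirichletCharacter.differentiable_LFunctionTrivChar₁ 1).differentiableOn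
    (s := {z : ℂ | 0 < z.re}) |>.analyticOnNhd hU
  have hG : AnalyticOnNhd ℂ (fun z ↦ z - z * (z - 1) * mellin fractTail (-z))
      {z : ℂ | 0 < z.re} := by
    refine DifferentiableOn.analyticOnNhd (fun z hz ↦ ?_) hU
    have : DifferentiableAt ℂ (fun z ↦ mellin fractTail (-z)) z :=
      (differentiableAt_mellin_fractTail (s := -z) (by simpa using hz)).comp z
        differentiableAt_id.neg
    exact (differentiableAt_id.sub ((differentiableAt_id.mul
      (differentiableAt_id.sub_const 1)).mul this)).differentiableWithinAt
  have hval : ∀ z : ℂ, z ≠ 1 →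
      DirichletCharacter.LFunctionTrivChar₁ 1 z = (z - 1) * riemannZeta z := by
    intro z hz
    rw [DirichletCharacter.LFunctionTrivChar₁, Function.update_of_ne hz,
      DirichletCharacter.LFunctionTrivChar, DirichletCharacter.LFunction_modOne_eq]
  have hV : {z : ℂ | 1 < z.re} ∈ nhds (2 : ℂ) :=
    (isOpen_lt continuous_const Complex.continuous_re).mem_nhds (by simp)
  have key := hF.eqOn_of_preconnected_of_eventuallyEq hG
    (convex_halfSpace_re_gt 0).isPreconnected (z₀ := 2) (by simp) (by
      filter_upwards [hV] with z hz
      have hz' : 1 < z.re := hz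
      rw [hval z (by rintro rfl; simp at hz'), riemannZeta_eq_mellin_fractTail_of_one_lt_re hz])
  rw [← hval s hs1]
  exact key hs

lemma norm_riemannZeta_sub_le {s : ℂ} (hs : 1 / 2 ≤ s.re) (hs1 : s ≠ 1) :
    ‖riemannZeta s - 1 / (s - 1)‖ ≤ 1 + 2 * ‖s‖ := by
  have h0 : s - 1 ≠ 0 := sub_ne_zero.mpr hs1
  have h : riemannZeta s - 1 / (s - 1) = 1 - s * mellin fractTail (-s) := by
    have := riemannZeta_eq_mellin_fractTail (by linarith) hs1
    field_simp
    rw [mul_comm, this]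
    ring
  rw [h]
  refine (norm_sub_le _ _).trans ?_
  rw [norm_one, norm_mul]
  have := norm_mellin_fractTail_le hs
  nlinarith [norm_nonneg s]

section Majorant

variable {ι : Type*} {c lam : ι → ℝ}

/-- The almost periodic function `u ↦ ∑ cᵢ cos (λᵢ u)`. -/
noncomputable def cosSum (c lam : ι → ℝ) (u : ℝ) : ℝ := ∑' i, c i * Real.cos (lam i * u)

lemma norm_mul_cos_le (hc0 : ∀ i, 0 ≤ c i) (i : ι) (u : ℝ) :
    ‖c i * Real.cos (lam i * u)‖ ≤ c i := by
  rw [norm_mul, Real.norm_of_nonneg (hc0 i)]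
  exact mul_le_of_le_one_right (hc0 i) (Real.abs_cos_le_one _)

lemma abs_cosSum_le (hc0 : ∀ i, 0 ≤ c i) (hc : Summable c) (u : ℝ) :
    |cosSum c lam u| ≤ ∑' i, c i :=
  tsum_of_norm_bounded hc.hasSum fun i ↦ norm_mul_cos_le hc0 i u

lemma continuous_cosSum (hc0 : ∀ i, 0 ≤ c i) (hc : Summable c) : Continuous (cosSum c lam) :=
  continuous_tsum (fun _ ↦ by fun_prop) hc fun i u ↦ norm_mul_cos_le hc0 i u

variable (μ : Measure ℝ)

/-- The Fourier transform of the `k`-th power of a translate of `cosSum c lam` with respect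
to `μ`. -/
noncomputable def cosSumFourier (c lam : ι → ℝ) (T : ℝ) (k : ℕ) (ξ : ℝ) : ℂ :=
  ∫ u, (cosSum c lam (T + u) : ℂ) ^ k * cexp (ξ * u * I) ∂μ

variable [IsProbabilityMeasure μ]

lemma integrable_cosSum_pow (hc0 : ∀ i, 0 ≤ c i) (hc : Summable c) (T : ℝ) (k : ℕ) (ξ : ℝ) :
    Integrable (fun u : ℝ ↦ (cosSum c lam (T + u) : ℂ) ^ k * cexp (ξ * u * I)) μ := by
  have hcont := continuous_cosSum (lam := lam) hc0 hc
  refine Integrable.of_bound (C := (∑' i, c i) ^ k) (Continuous.aestronglyMeasurable ?_)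
    (.of_forall fun u ↦ ?_)
  · fun_prop
  · rw [norm_mul, ← ofReal_mul, Complex.norm_exp_ofReal_mul_I, mul_one, norm_pow, Complex.norm_real]
    exact pow_le_pow_left₀ (norm_nonneg _) (abs_cosSum_le hc0 hc _) k

lemma hasSum_cosSumFourier_succ [Countable ι] (hc0 : ∀ i, 0 ≤ c i) (hc : Summable c)
    (T : ℝ) (k : ℕ) (ξ : ℝ) :
    HasSum (fun i ↦ (c i / 2 : ℂ) * (cexp (lam i * T * I) * cosSumFourier μ c lam T k (ξ + lam i) +
      cexp (-(lam i * T * I)) * cosSumFourier μ c lam T k (ξ - lam i)))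
      (cosSumFourier μ c lam T (k + 1) ξ) := by
  have hint := fun ξ ↦ integrable_cosSum_pow (lam := lam) μ hc0 hc T k ξ
  let F : ι → ℝ → ℂ := fun i u ↦ (c i / 2 : ℂ) *
    (cexp (lam i * T * I) * ((cosSum c lam (T + u) : ℂ) ^ k * cexp ((ξ + lam i : ℝ) * u * I)) +
     cexp (-(lam i * T * I)) * ((cosSum c lam (T + u) : ℂ) ^ k * cexp ((ξ - lam i : ℝ) * u * I)))
  have hF : ∀ i u, F i u = (c i * Real.cos (lam i * (T + u)) : ℝ) *
      ((cosSum c lam (T + u) : ℂ) ^ k * cexp (ξ * u * I)) := by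
    intro i u
    have e1 : cexp (lam i * T * I) * cexp ((ξ + lam i : ℝ) * u * I) =
        cexp (lam i * (T + u) * I) * cexp (ξ * u * I) := by
      rw [← Complex.exp_add, ← Complex.exp_add]; push_cast; ring_nf
    have e2 : cexp (-(lam i * T * I)) * cexp ((ξ - lam i : ℝ) * u * I) =
        cexp (-(lam i * (T + u)) * I) * cexp (ξ * u * I) := by
      rw [← Complex.exp_add, ← Complex.exp_add]; push_cast; ring_nf
    push_cast
    rw [Complex.cos]
    calc F i u = (c i / 2 : ℂ) * (cosSum c lam (T + u) : ℂ) ^ k *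
          (cexp (lam i * T * I) * cexp ((ξ + lam i : ℝ) * u * I) +
          cexp (-(lam i * T * I)) * cexp ((ξ - lam i : ℝ) * u * I)) := by simp only [F]; ring
      _ = _ := by rw [e1, e2]; ring
  have hFi : ∀ i, Integrable (F i) μ := fun i ↦
    (((hint _).const_mul _).add ((hint _).const_mul _)).const_mul _
  have hbound : ∀ i u, ‖F i u‖ ≤ c i * (∑' i, c i) ^ k := by
    intro i u
    rw [hF, norm_mul, norm_mul, ← ofReal_mul, Complex.norm_exp_ofReal_mul_I, mul_one, norm_pow,
      Complex.norm_real, Complex.norm_real]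
    exact mul_le_mul (norm_mul_cos_le hc0 i _)
      (pow_le_pow_left₀ (norm_nonneg _) (abs_cosSum_le hc0 hc _) k) (by positivity) (hc0 i)
  have hsum := hasSum_integral_of_summable_integral_norm hFi (by
    refine (hc.mul_right ((∑' i, c i) ^ k)).of_nonneg_of_le
      (fun i ↦ integral_nonneg fun _ ↦ norm_nonneg _) fun i ↦ ?_
    calc ∫ u, ‖F i u‖ ∂μ ≤ ∫ _, c i * (∑' i, c i) ^ k ∂μ :=
          integral_mono (hFi i).norm (integrable_const _) (hbound i)
      _ = _ := by simp)
  convert! hsum using 1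
  · ext i
    simp only [F, cosSumFourier]
    rw [MeasureTheory.integral_const_mul, integral_add ((hint _).const_mul _) ((hint _).const_mul _),
      MeasureTheory.integral_const_mul, MeasureTheory.integral_const_mul]
  · simp only [cosSumFourier, hF]
    congr 1
    ext u
    rw [tsum_mul_right, ← ofReal_tsum, pow_succ, cosSum]
    ring

lemma norm_cosSumFourier_le [Countable ι] (hc0 : ∀ i, 0 ≤ c i) (hc : Summable c)
    (hμ : ∀ ξ : ℝ, ‖charFun μ ξ‖ ≤ (charFun μ ξ).re) (T : ℝ) (k : ℕ) (ξ : ℝ) :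
    ‖cosSumFourier μ c lam T k ξ‖ ≤ (cosSumFourier μ c lam 0 k ξ).re := by
  induction k generalizing ξ with
  | zero =>
    simpa only [cosSumFourier, pow_zero, one_mul, charFun_apply_real] using hμ ξ
  | succ k ih =>
    have h0 := hasSum_cosSumFourier_succ (lam := lam) μ hc0 hc 0 k ξ
    have hT := hasSum_cosSumFourier_succ (lam := lam) μ hc0 hc T k ξ
    rw [← hT.tsum_eq]
    refine tsum_of_norm_bounded (Complex.hasSum_re h0) fun i ↦ ?_
    have e : (c i / 2 : ℂ) = ((c i / 2 : ℝ) : ℂ) := by push_cast; rfl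
    have hci : 0 ≤ c i / 2 := by linarith [hc0 i]
    rw [e, norm_mul, Complex.norm_real, Real.norm_of_nonneg hci, Complex.re_ofReal_mul]
    refine mul_le_mul_of_nonneg_left ?_ hci
    simp only [ofReal_zero, mul_zero, zero_mul, neg_zero, Complex.exp_zero, one_mul, add_re]
    refine (norm_add_le _ _).trans (add_le_add ?_ ?_)
    · rw [norm_mul, ← ofReal_mul, Complex.norm_exp_ofReal_mul_I, one_mul]
      exact ih _
    · rw [norm_mul, ← ofReal_mul, ← neg_mul, ← ofReal_neg, Complex.norm_exp_ofReal_mul_I, one_mul]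
      exact ih _

lemma hasSum_integral_exp_cosSum (hc0 : ∀ i, 0 ≤ c i) (hc : Summable c) (T a : ℝ) :
    HasSum (fun k : ℕ ↦ ((a ^ k / k.factorial : ℝ) : ℂ) * cosSumFourier μ c lam T k 0)
      ((∫ u, Real.exp (a * cosSum c lam (T + u)) ∂μ : ℝ) : ℂ) := by
  have hint := fun k ↦ integrable_cosSum_pow (lam := lam) μ hc0 hc T k 0
  let F : ℕ → ℝ → ℂ := fun k u ↦ ((a ^ k / k.factorial : ℝ) : ℂ) *
    ((cosSum c lam (T + u) : ℂ) ^ k * cexp ((0 : ℝ) * u * I))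
  have hF : ∀ k u, F k u = (((a * cosSum c lam (T + u)) ^ k / k.factorial : ℝ) : ℂ) := by
    intro k u
    simp only [F]
    push_cast
    rw [zero_mul, zero_mul, Complex.exp_zero, mul_pow]
    ring
  have hFi : ∀ k, Integrable (F k) μ := fun k ↦ (hint k).const_mul _
  have hbound : ∀ k u, ‖F k u‖ ≤ (|a| * ∑' i, c i) ^ k / k.factorial := by
    intro k u
    rw [hF, Complex.norm_real, norm_div, norm_pow, norm_mul, Real.norm_natCast]
    refine div_le_div_of_nonneg_right (pow_le_pow_left₀ (by positivity) ?_ k) (by positivity)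
    exact mul_le_mul_of_nonneg_left (abs_cosSum_le hc0 hc _) (abs_nonneg a)
  have hsum := hasSum_integral_of_summable_integral_norm hFi (by
    refine (Real.summable_pow_div_factorial (|a| * ∑' i, c i)).of_nonneg_of_le
      (fun i ↦ integral_nonneg fun _ ↦ norm_nonneg _) fun k ↦ ?_
    calc ∫ u, ‖F k u‖ ∂μ ≤ ∫ _, (|a| * ∑' i, c i) ^ k / k.factorial ∂μ :=
          integral_mono (hFi k).norm (integrable_const _) (hbound k)
      _ = _ := by simp)
  convert! hsum using 1
  · ext k
    simp only [F, cosSumFourier]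
    rw [MeasureTheory.integral_const_mul]
  · rw [← integral_complex_ofReal]
    congr 1
    ext u
    simp only [hF]
    rw [← ofReal_tsum, Real.exp_eq_exp_ℝ, NormedSpace.exp_eq_tsum_div]

/-- Majorant principle: translating the phases and flipping the sign in the exponent can only
decrease the mean of `exp (∑ cᵢ cos (λᵢ u))`. -/
theorem integral_exp_neg_cosSum_le [Countable ι] (hc0 : ∀ i, 0 ≤ c i) (hc : Summable c)
    (hμ : ∀ ξ : ℝ, ‖charFun μ ξ‖ ≤ (charFun μ ξ).re) (T : ℝ) :
    ∫ u, Real.exp (-cosSum c lam (T + u)) ∂μ ≤ ∫ u, Real.exp (cosSum c lam u) ∂μ := by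
  have h1 := hasSum_integral_exp_cosSum (lam := lam) μ hc0 hc T (-1)
  have h2 := Complex.hasSum_re (hasSum_integral_exp_cosSum (lam := lam) μ hc0 hc 0 1)
  simp only [neg_one_mul, one_mul, zero_add] at h1 h2
  refine (le_abs_self _).trans ?_
  rw [← Real.norm_eq_abs, ← Complex.norm_real, ← h1.tsum_eq]
  refine tsum_of_norm_bounded h2 fun k ↦ ?_
  rw [norm_mul, Complex.norm_real, Complex.re_ofReal_mul, norm_div, norm_pow, norm_neg, norm_one,
    Real.norm_natCast]
  exact mul_le_mul_of_nonneg_left (norm_cosSumFourier_le μ hc0 hc hμ T k 0) (by positivity)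

end Majorant

/-- The coefficients of `log ζ(σ + iu)` as a Dirichlet series in `n ^ (-iu)`. -/
noncomputable def logZetaCoeff (σ : ℝ) (n : ℕ) : ℝ :=
  ArithmeticFunction.vonMangoldt n / Real.log n * (n : ℝ) ^ (-σ)

lemma logZetaCoeff_nonneg (σ : ℝ) (n : ℕ) : 0 ≤ logZetaCoeff σ n :=
  mul_nonneg (div_nonneg ArithmeticFunction.vonMangoldt_nonneg (Real.log_natCast_nonneg n))
    (by positivity)

lemma summable_logZetaCoeff {σ : ℝ} (hσ : 1 < σ) : Summable (logZetaCoeff σ) := by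
  refine (Real.summable_nat_rpow.mpr (by linarith : -σ < -1)).of_nonneg_of_le
    (logZetaCoeff_nonneg σ) fun n ↦ ?_
  exact mul_le_of_le_one_left (by positivity)
    (div_le_one_of_le₀ ArithmeticFunction.vonMangoldt_le_log (Real.log_natCast_nonneg n))

lemma norm_riemannZeta_eq_exp_cosSum {σ : ℝ} (hσ : 1 < σ) (u : ℝ) :
    ‖riemannZeta (σ + u * I)‖ =
      Real.exp (cosSum (logZetaCoeff σ) (fun n : ℕ ↦ Real.log n) u) := by
  rw [← riemannZeta_eq_exp_LSeries (by simpa using hσ), Complex.norm_exp, LSeries_def₀ (by simp),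
    cosSum]
  congr 1
  have hterm : ∀ n : ℕ, ((ArithmeticFunction.vonMangoldt n : ℂ) / Real.log n /
      (n : ℂ) ^ ((σ : ℂ) + u * I)) =
      (logZetaCoeff σ n : ℂ) * cexp (-(Real.log n * u : ℝ) * I) := by
    intro n
    rcases Nat.eq_zero_or_pos n with rfl | hn
    · simp [logZetaCoeff]
    have hn' : (n : ℂ) ≠ 0 := by exact_mod_cast hn.ne'
    rw [logZetaCoeff, div_eq_mul_inv _ ((n : ℂ) ^ _), ← cpow_neg, neg_add, cpow_add _ _ hn']
    push_cast
    rw [ofReal_cpow (by positivity), cpow_def_of_ne_zero hn' (-(u * I)), ← natCast_log]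
    push_cast
    ring_nf
  have hsum : Summable fun n : ℕ ↦ (logZetaCoeff σ n : ℂ) * cexp (-(Real.log n * u : ℝ) * I) := by
    refine (summable_logZetaCoeff hσ).of_norm_bounded fun n ↦ ?_
    rw [norm_mul, ← ofReal_neg, Complex.norm_exp_ofReal_mul_I, mul_one, Complex.norm_real,
      Real.norm_of_nonneg (logZetaCoeff_nonneg σ n)]
  simp_rw [hterm]
  rw [Complex.re_tsum hsum]
  refine tsum_congr fun n ↦ ?_
  rw [Complex.re_ofReal_mul, ← ofReal_neg, Complex.exp_ofReal_mul_I_re, Real.cos_neg]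

lemma inv_norm_riemannZeta_le {σ : ℝ} (hσ : 1 < σ) (u : ℝ) :
    ‖riemannZeta (σ + u * I)‖⁻¹ ≤ ‖riemannZeta σ‖ := by
  have h0 := norm_riemannZeta_eq_exp_cosSum hσ 0
  rw [ofReal_zero, zero_mul, add_zero] at h0
  rw [h0, norm_riemannZeta_eq_exp_cosSum hσ, ← Real.exp_neg, Real.exp_le_exp]
  have h1 := abs_cosSum_le (lam := fun n : ℕ ↦ Real.log n) (logZetaCoeff_nonneg σ)
    (summable_logZetaCoeff hσ) u
  have h2 : cosSum (logZetaCoeff σ) (fun n : ℕ ↦ Real.log n) 0 = ∑' n, logZetaCoeff σ n := by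
    simp [cosSum]
  rw [h2]
  exact (neg_le_abs _).trans h1

open ProbabilityTheory in
lemma norm_charFun_gaussianReal_le (ξ : ℝ) :
    ‖charFun (gaussianReal 0 1) ξ‖ ≤ (charFun (gaussianReal 0 1) ξ).re := by
  have : charFun (gaussianReal 0 1) ξ = ((Real.exp (-ξ ^ 2 / 2) : ℝ) : ℂ) := by
    rw [charFun_gaussianReal]
    push_cast
    congr 1
    simp
    ring
  rw [this, Complex.norm_real, ofReal_re, Real.norm_of_nonneg (Real.exp_pos _).le]

open ProbabilityTheory in
lemma integral_gaussianReal_inv_norm_riemannZeta_le {σ : ℝ} (hσ : 1 < σ) (T : ℝ) :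
    ∫ u, ‖riemannZeta (σ + (T + u : ℝ) * I)‖⁻¹ ∂(gaussianReal 0 1) ≤
      ∫ u, ‖riemannZeta (σ + (u : ℝ) * I)‖ ∂(gaussianReal 0 1) := by
  simp_rw [norm_riemannZeta_eq_exp_cosSum hσ, ← Real.exp_neg]
  exact integral_exp_neg_cosSum_le _ (logZetaCoeff_nonneg σ) (summable_logZetaCoeff hσ)
    norm_charFun_gaussianReal_le T

lemma norm_riemannZeta_one_add_le {η : ℝ} (hη : 0 < η) (hη1 : η ≤ 1) (u : ℝ) :
    ‖riemannZeta ((1 + η : ℝ) + u * I)‖ ≤ 2 * (η + |u|)⁻¹ + (5 + 2 * |u|) := by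
  have hs1 : ((1 + η : ℝ) : ℂ) + u * I ≠ 1 := by
    intro h
    have := congrArg Complex.re h
    simp at this
    linarith
  have h := norm_riemannZeta_sub_le (s := ((1 + η : ℝ) : ℂ) + u * I) (by simp; linarith) hs1
  have h1 : ‖((1 + η : ℝ) : ℂ) + u * I‖ ≤ 2 + |u| := by
    refine (norm_add_le _ _).trans ?_
    rw [norm_mul, norm_I, Complex.norm_real, Complex.norm_real, mul_one, Real.norm_eq_abs,
      Real.norm_eq_abs, abs_of_pos (by linarith)]
    linarith
  have h2 : η + |u| ≤ 2 * ‖((1 + η : ℝ) : ℂ) + u * I - 1‖ := by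
    have a := Complex.abs_re_le_norm (((1 + η : ℝ) : ℂ) + u * I - 1)
    have b := Complex.abs_im_le_norm (((1 + η : ℝ) : ℂ) + u * I - 1)
    simp at a b
    rw [abs_of_pos hη] at a
    push_cast
    linarith
  have h3 : ‖1 / (((1 + η : ℝ) : ℂ) + u * I - 1)‖ ≤ 2 * (η + |u|)⁻¹ := by
    have hp : 0 < η + |u| := by positivity
    rw [norm_div, norm_one, div_le_iff₀ (by linarith), mul_assoc, inv_mul_eq_div]
    rw [← mul_div_assoc, le_div_iff₀ hp]
    linarith
  have := norm_sub_norm_le (riemannZeta ((1 + η : ℝ) + u * I))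
    (1 / (((1 + η : ℝ) : ℂ) + u * I - 1))
  linarith

lemma integral_inv_add_abs_le {η : ℝ} (hη : 0 < η) (hη1 : η ≤ 1) :
    ∫ u in (-1 : ℝ)..1, (η + |u|)⁻¹ ≤ 2 * (1 + Real.log η⁻¹) := by
  have hc : Continuous fun u : ℝ ↦ (η + |u|)⁻¹ :=
    Continuous.inv₀ (by fun_prop) fun u ↦ by positivity
  have hI : ∀ a b : ℝ, IntervalIntegrable (fun u : ℝ ↦ (η + |u|)⁻¹) volume a b :=
    fun a b ↦ hc.intervalIntegrable a b
  have h1 : ∫ u in (0 : ℝ)..1, (η + |u|)⁻¹ ≤ 1 + Real.log η⁻¹ := by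
    have e : ∫ u in (0 : ℝ)..1, (η + |u|)⁻¹ = ∫ u in (0 : ℝ)..1, (η + u)⁻¹ := by
      refine intervalIntegral.integral_congr fun u hu ↦ ?_
      rw [Set.uIcc_of_le zero_le_one] at hu
      simp only [abs_of_nonneg hu.1]
    rw [e, intervalIntegral.integral_comp_add_left (fun x ↦ x⁻¹), integral_inv_of_pos (by linarith)
      (by linarith), add_zero, div_eq_mul_inv, Real.log_mul (by positivity) (by positivity)]
    have := Real.log_le_sub_one_of_pos (by linarith : 0 < η + 1)
    linarith
  have h2 : ∫ u in (-1 : ℝ)..0, (η + |u|)⁻¹ = ∫ u in (0 : ℝ)..1, (η + |u|)⁻¹ := by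
    have := intervalIntegral.integral_comp_neg (a := 0) (b := 1) (fun u : ℝ ↦ (η + |u|)⁻¹)
    simpa using this.symm
  rw [← intervalIntegral.integral_add_adjacent_intervals (hI (-1) 0) (hI 0 1), h2]
  linarith

open ProbabilityTheory in
lemma exists_integral_gaussianReal_norm_riemannZeta_le :
    ∃ K : ℝ, 0 < K ∧ ∀ η : ℝ, 0 < η → η ≤ 1 →
      ∫ u, ‖riemannZeta ((1 + η : ℝ) + (u : ℝ) * I)‖ ∂(gaussianReal 0 1) ≤
        K + 4 * Real.log η⁻¹ := by
  set μ := gaussianReal 0 1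
  have hid : Integrable (fun u : ℝ ↦ |u|) μ := by
    have := (memLp_id_gaussianReal (μ := 0) (v := 1) 1).integrable (by simp)
    exact this.abs
  have hlin : Integrable (fun u : ℝ ↦ 5 + 2 * |u|) μ :=
    (integrable_const _).add (hid.const_mul 2)
  refine ⟨6 + ∫ u, (5 + 2 * |u|) ∂μ, ?_, fun η hη hη1 ↦ ?_⟩
  · have : 0 ≤ ∫ u, (5 + 2 * |u|) ∂μ := integral_nonneg fun u ↦ by positivity
    linarith
  have hc : Continuous fun u : ℝ ↦ (η + |u|)⁻¹ :=
    Continuous.inv₀ (by fun_prop) fun u ↦ by positivity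
  have hinv : Integrable (fun u : ℝ ↦ (η + |u|)⁻¹) μ := by
    refine Integrable.of_bound (C := η⁻¹) hc.aestronglyMeasurable (.of_forall fun u ↦ ?_)
    rw [Real.norm_of_nonneg (by positivity)]
    exact inv_anti₀ hη (by linarith [abs_nonneg u])
  have hind : Integrable ((Set.Ioc (-1 : ℝ) 1).indicator fun u : ℝ ↦ (η + |u|)⁻¹) μ :=
    hinv.indicator measurableSet_Ioc
  have hsplit : ∫ u, (η + |u|)⁻¹ ∂μ ≤ 2 * (1 + Real.log η⁻¹) + 1 := by
    have h1 : ∫ u, (η + |u|)⁻¹ ∂μ ≤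
        ∫ u, ((Set.Ioc (-1 : ℝ) 1).indicator (fun u : ℝ ↦ (η + |u|)⁻¹) u + 1) ∂μ := by
      refine integral_mono hinv (hind.add (integrable_const _)) fun u ↦ ?_
      by_cases hu : u ∈ Set.Ioc (-1 : ℝ) 1
      · simp only [Set.indicator_of_mem hu]
        linarith
      · simp only [Set.indicator_of_notMem hu, zero_add]
        have : 1 ≤ |u| := by
          by_contra! hlt
          exact hu ⟨(abs_lt.mp hlt).1, (abs_lt.mp hlt).2.le⟩
        exact inv_le_one_of_one_le₀ (by linarith)
    have h2 : ∫ u, (Set.Ioc (-1 : ℝ) 1).indicator (fun u : ℝ ↦ (η + |u|)⁻¹) u ∂μ ≤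
        ∫ u in (-1 : ℝ)..1, (η + |u|)⁻¹ := by
      rw [integral_gaussianReal_eq_integral_smul one_ne_zero,
        intervalIntegral.integral_of_le (by norm_num), ← MeasureTheory.integral_indicator
        measurableSet_Ioc]
      refine integral_mono_of_nonneg (.of_forall fun u ↦ ?_) ?_ (.of_forall fun u ↦ ?_)
      · exact mul_nonneg (gaussianPDFReal_nonneg _ _ _)
          (Set.indicator_nonneg (fun _ _ ↦ by positivity) _)
      · exact (hc.integrableOn_Icc.mono_set Set.Ioc_subset_Icc_self).integrable_indicator
          measurableSet_Ioc
      · refine mul_le_of_le_one_left (Set.indicator_nonneg (fun _ _ ↦ by positivity) _) ?_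
        rw [gaussianPDFReal]
        refine mul_le_one₀ (inv_le_one_of_one_le₀ ?_) (Real.exp_pos _).le
          (Real.exp_le_one_iff.mpr ?_)
        · rw [Real.one_le_sqrt]
          push_cast
          linarith [Real.pi_gt_three]
        · rw [neg_div]
          exact neg_nonpos.mpr (by positivity)
    have h3 := integral_inv_add_abs_le hη hη1
    rw [integral_add hind (integrable_const _)] at h1
    simp only [MeasureTheory.integral_const, probReal_univ, smul_eq_mul, mul_one] at h1
    linarith
  calc _ ≤ ∫ u, (2 * (η + |u|)⁻¹ + (5 + 2 * |u|)) ∂μ :=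
        integral_mono_of_nonneg (.of_forall fun u ↦ norm_nonneg _)
          ((hinv.const_mul 2).add hlin)
          (.of_forall fun u ↦ norm_riemannZeta_one_add_le hη hη1 u)
    _ ≤ _ := by
        rw [integral_add (hinv.const_mul 2) hlin, MeasureTheory.integral_const_mul]
        linarith

open ProbabilityTheory in
lemma intervalIntegral_le_mul_integral_gaussianReal {f : ℝ → ℝ} (hf : ∀ u, 0 ≤ f u)
    (hfi : Integrable f (gaussianReal 0 1)) {δ : ℝ} (hδ : 0 < δ) :
    ∫ u in (0 : ℝ)..δ, f u ≤
      √(2 * π) * Real.exp (δ ^ 2 / 2) * ∫ u, f u ∂(gaussianReal 0 1) := by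
  have hi : Integrable (fun u ↦ gaussianPDFReal 0 1 u * f u) := by
    rw [gaussianReal_of_var_ne_zero _ one_ne_zero, integrable_withDensity_iff_integrable_smul'
      (measurable_gaussianPDF _ _) (.of_forall fun _ ↦ gaussianPDF_lt_top)] at hfi
    simpa [toReal_gaussianPDF] using hfi
  rw [integral_gaussianReal_eq_integral_smul one_ne_zero, ← MeasureTheory.integral_const_mul,
    intervalIntegral.integral_of_le hδ.le, ← MeasureTheory.integral_indicator measurableSet_Ioc]
  refine integral_mono_of_nonneg (.of_forall fun u ↦ Set.indicator_nonneg (fun _ _ ↦ hf _) _)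
    (hi.const_mul _) (.of_forall fun u ↦ ?_)
  by_cases hu : u ∈ Set.Ioc 0 δ
  · simp only [Set.indicator_of_mem hu, smul_eq_mul, ← mul_assoc]
    refine le_mul_of_one_le_left (hf u) ?_
    rw [gaussianPDFReal]
    have hs : √(2 * π) ≠ 0 := by positivity
    have : √(2 * π) * Real.exp (δ ^ 2 / 2) * ((√(2 * π * ((1 : NNReal) : ℝ)))⁻¹ *
        Real.exp (-(u - 0) ^ 2 / (2 * ((1 : NNReal) : ℝ)))) =
        Real.exp (δ ^ 2 / 2 - u ^ 2 / 2) := by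
      rw [Real.exp_sub, sub_zero, NNReal.coe_one, mul_one, mul_one, neg_div, Real.exp_neg]
      field_simp
    rw [this, Real.one_le_exp_iff]
    nlinarith [hu.1, hu.2]
  · simp only [Set.indicator_of_notMem hu, smul_eq_mul]
    have := mul_nonneg (gaussianPDFReal_nonneg 0 1 u) (hf u)
    positivity

open Complex.HadamardThreeLines in
/-- **Hadamard three-circles theorem**. -/
lemma norm_le_interp_of_mem_annulus {f : ℂ → ℂ} {c z : ℂ} {r R a b : ℝ} (hr : 0 < r) (hrR : r < R)
    (hd : ∀ w ∈ Metric.closedBall c R, DifferentiableAt ℂ f w)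
    (ha : ∀ w, ‖w - c‖ = r → ‖f w‖ ≤ a) (hb : ∀ w, ‖w - c‖ = R → ‖f w‖ ≤ b)
    (hrz : r ≤ ‖z - c‖) (hzR : ‖z - c‖ ≤ R) :
    ‖f z‖ ≤ a ^ (1 - (Real.log ‖z - c‖ - Real.log r) / (Real.log R - Real.log r)) *
      b ^ ((Real.log ‖z - c‖ - Real.log r) / (Real.log R - Real.log r)) := by
  have hR : 0 < R := hr.trans hrR
  have hul : Real.log r < Real.log R := Real.log_lt_log hr hrR
  have hz0 : z - c ≠ 0 := by
    intro h
    rw [h, norm_zero] at hrz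
    linarith
  have hmem : ∀ w ∈ verticalClosedStrip (Real.log r) (Real.log R),
      c + cexp w ∈ Metric.closedBall c R := by
    intro w hw
    rw [mem_closedBall_iff_norm, add_sub_cancel_left, Complex.norm_exp, ← Real.le_log_iff_exp_le hR]
    exact hw.2
  have key := norm_le_interp_of_mem_verticalClosedStrip' (f := fun w ↦ f (c + cexp w))
    (z := Complex.log (z - c)) (a := a) (b := b) hul ?_ ?_ ?_ ?_ ?_
  · simpa only [Complex.exp_log hz0, add_sub_cancel, Complex.log_re] using key
  · simp only [verticalClosedStrip, Set.mem_preimage, Complex.log_re]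
    exact ⟨Real.log_le_log hr hrz, Real.log_le_log (hr.trans_le hrz) hzR⟩
  · refine DifferentiableOn.diffContOnCl fun w hw ↦ ?_
    have hw' : w ∈ verticalClosedStrip (Real.log r) (Real.log R) :=
      closure_minimal (Set.preimage_mono Set.Ioo_subset_Icc_self)
        (isClosed_Icc.preimage Complex.continuous_re) hw
    have h1 : DifferentiableAt ℂ (fun w ↦ c + cexp w) w := by fun_prop
    exact ((hd _ (hmem w hw')).comp w h1).differentiableWithinAt
  · have hcont : ContinuousOn f (Metric.closedBall c R) :=
      fun w hw ↦ (hd w hw).continuousAt.continuousWithinAt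
    obtain ⟨B, hB⟩ := (isCompact_closedBall c R).exists_bound_of_continuousOn hcont
    refine ⟨B, ?_⟩
    rintro _ ⟨w, hw, rfl⟩
    exact hB _ (hmem w hw)
  · intro w hw
    refine ha _ ?_
    rw [add_sub_cancel_left, Complex.norm_exp, Set.mem_singleton_iff.mp hw, Real.exp_log hr]
  · intro w hw
    refine hb _ ?_
    rw [add_sub_cancel_left, Complex.norm_exp, Set.mem_singleton_iff.mp hw, Real.exp_log hR]

/-- A nonvanishing holomorphic function on a disc has a holomorphic logarithm there. -/
lemma exists_log_on_ball {f : ℂ → ℂ} {c : ℂ} {R : ℝ} (hR : 0 < R)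
    (hf : DifferentiableOn ℂ f (Metric.ball c R)) (hf0 : ∀ z ∈ Metric.ball c R, f z ≠ 0) :
    ∃ L : ℂ → ℂ, L c = 0 ∧ (∀ z ∈ Metric.ball c R, HasDerivAt L (deriv f z / f z) z) ∧
      ∀ z ∈ Metric.ball c R, f z = f c * cexp (L z) := by
  have hd : DifferentiableOn ℂ (fun z ↦ deriv f z / f z) (Metric.ball c R) :=
    (hf.deriv Metric.isOpen_ball).div hf hf0
  obtain ⟨L, hL0, hL⟩ := hd.isExactOn_ball.with_val_at c 0
  refine ⟨L, hL0, hL, fun z hz ↦ ?_⟩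
  have hg : ∀ w ∈ Metric.ball c R,
      HasDerivWithinAt (fun w ↦ f w * cexp (-L w)) 0 (Metric.ball c R) w := by
    intro w hw
    have h1 := (hf.differentiableAt (Metric.isOpen_ball.mem_nhds hw)).hasDerivAt
    have h2 := h1.mul (hL w hw).neg.cexp
    refine (h2.congr_deriv ?_).hasDerivWithinAt
    field_simp [hf0 w hw]
    ring
  have h := (convex_ball c R).norm_image_sub_le_of_norm_hasDerivWithin_le (C := 0) hg (by simp)
    (Metric.mem_ball_self hR) hz
  rw [zero_mul, norm_le_zero_iff, sub_eq_zero, hL0, neg_zero, Complex.exp_zero, mul_one] at h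
  rw [← h, mul_assoc, ← Complex.exp_add, neg_add_cancel, Complex.exp_zero, mul_one]

lemma exists_norm_deriv_riemannZeta_div_le :
    ∃ K : ℝ, 1 ≤ K ∧ ∀ η : ℝ, 0 < η → η ≤ 1 → ∀ s : ℂ, 1 + η ≤ s.re →
      ‖deriv riemannZeta s / riemannZeta s‖ ≤ K / η := by
  have hcont := DirichletCharacter.continuousOn_neg_logDeriv_LFunctionTrivChar₁ 1
  have hsub : (fun x : ℝ ↦ (x : ℂ)) '' Set.Icc 1 2 ⊆
      {s | s = 1 ∨ DirichletCharacter.LFunctionTrivChar 1 s ≠ 0} := by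
    rintro _ ⟨x, hx, rfl⟩
    right
    rw [DirichletCharacter.LFunctionTrivChar, DirichletCharacter.LFunction_modOne_eq]
    exact riemannZeta_ne_zero_of_one_le_re (by simpa using hx.1)
  obtain ⟨B, hB⟩ := (isCompact_Icc.image Complex.continuous_ofReal).exists_bound_of_continuousOn
    (hcont.mono hsub)
  have hreal : ∀ η : ℝ, 0 < η → η ≤ 1 →
      ‖deriv riemannZeta (1 + η : ℝ) / riemannZeta (1 + η : ℝ)‖ ≤ (1 + |B|) / η := by
    intro η hη hη1
    have hne : ((1 + η : ℝ) : ℂ) ≠ 1 := by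
      intro h
      have : 1 + η = 1 := by exact_mod_cast h
      linarith
    have h := hB ((1 + η : ℝ) : ℂ) ⟨1 + η, ⟨by linarith, by linarith⟩, rfl⟩
    have hz : riemannZeta ((1 + η : ℝ) : ℂ) ≠ 0 :=
      riemannZeta_ne_zero_of_one_le_re (by simp; linarith)
    have hη0 : (η : ℂ) ≠ 0 := by exact_mod_cast hη.ne'
    rw [DirichletCharacter.deriv_LFunctionTrivChar₁_apply_of_ne_one 1 hne,
      DirichletCharacter.LFunctionTrivChar₁, Function.update_of_ne hne,
      DirichletCharacter.LFunctionTrivChar, DirichletCharacter.LFunction_modOne_eq] at h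
    have e : deriv riemannZeta (1 + η : ℝ) / riemannZeta (1 + η : ℝ) =
        -(-((((1 + η : ℝ) : ℂ) - 1) * deriv riemannZeta (1 + η : ℝ) + riemannZeta (1 + η : ℝ)) /
          ((((1 + η : ℝ) : ℂ) - 1) * riemannZeta (1 + η : ℝ))) - 1 / (η : ℂ) := by
      push_cast at hz ⊢
      rw [add_sub_cancel_left]
      field_simp
      ring
    rw [e]
    refine (norm_sub_le _ _).trans ?_
    have hn : ‖1 / (η : ℂ)‖ = 1 / η := by
      rw [norm_div, norm_one, Complex.norm_real, Real.norm_of_nonneg hη.le]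
    rw [norm_neg, hn]
    have h1 : |B| ≤ |B| / η := le_div_self (abs_nonneg B) hη hη1
    have h2 := h.trans (le_abs_self B)
    rw [add_div]
    linarith
  refine ⟨1 + |B|, by linarith [abs_nonneg B], fun η hη hη1 s hs ↦ ?_⟩
  refine le_trans ?_ (hreal η hη hη1)
  have e1 : ∀ z : ℂ, 1 < z.re → ‖deriv riemannZeta z / riemannZeta z‖ =
      ‖LSeries (fun n ↦ (ArithmeticFunction.vonMangoldt n : ℂ)) z‖ := by
    intro z hz
    rw [ArithmeticFunction.LSeries_vonMangoldt_eq_deriv_riemannZeta_div hz, neg_div, norm_neg]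
  have hre : 1 < (((1 + η : ℝ) : ℂ)).re := by simp; linarith
  rw [e1 s (by linarith), e1 _ hre]
  have hsum := ArithmeticFunction.LSeriesSummable_vonMangoldt hre
  have e2 : ∀ n, LSeries.term (fun n ↦ (ArithmeticFunction.vonMangoldt n : ℂ)) (1 + η : ℝ) n =
      ((‖LSeries.term (fun n ↦ (ArithmeticFunction.vonMangoldt n : ℂ)) (1 + η : ℝ) n‖ : ℝ) : ℂ) := by
    intro n
    rcases eq_or_ne n 0 with rfl | hn
    · simp
    rw [LSeries.term_of_ne_zero hn]
    have : ((n : ℂ)) ^ ((1 + η : ℝ) : ℂ) = (((n : ℝ) ^ (1 + η) : ℝ) : ℂ) := by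
      rw [ofReal_cpow (by positivity)]
      simp
    rw [this, ← ofReal_div, Complex.norm_real, Real.norm_of_nonneg]
    exact div_nonneg ArithmeticFunction.vonMangoldt_nonneg (by positivity)
  have e3 : ‖LSeries (fun n ↦ (ArithmeticFunction.vonMangoldt n : ℂ)) (1 + η : ℝ)‖ =
      ∑' n, ‖LSeries.term (fun n ↦ (ArithmeticFunction.vonMangoldt n : ℂ)) (1 + η : ℝ) n‖ := by
    rw [LSeries, tsum_congr e2, ← ofReal_tsum, Complex.norm_real, Real.norm_of_nonneg]
    exact tsum_nonneg fun _ ↦ norm_nonneg _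
  rw [e3]
  exact tsum_of_norm_bounded hsum.norm.hasSum fun n ↦
    LSeries.norm_term_le_of_re_le_re _ (by simpa using hs) n

/-- Under the Riemann hypothesis, `ζ` has a logarithm of size `O(log t)` on a disc around `2 + it`
that reaches to the left of the line `Re s = 1`. -/
lemma RiemannHypothesis.exists_log_riemannZeta (hRH : RiemannHypothesis) :
    ∃ t₀ : ℝ, 8 ≤ t₀ ∧ ∀ t : ℝ, t₀ ≤ t → ∃ L : ℂ → ℂ,
      (∀ z ∈ Metric.ball ((2 : ℝ) + t * I) (5 / 4),
        HasDerivAt L (deriv riemannZeta z / riemannZeta z) z) ∧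
      (∀ z ∈ Metric.ball ((2 : ℝ) + t * I) (5 / 4),
        riemannZeta z = riemannZeta ((2 : ℝ) + t * I) * cexp (L z)) ∧
      ∀ z : ℂ, ‖z - ((2 : ℝ) + t * I)‖ ≤ 19 / 16 → ‖L z‖ ≤ 76 * Real.log t := by
  refine ⟨max 9 (3 * ‖riemannZeta (2 : ℝ)‖), (by norm_num : (8 : ℝ) ≤ 9).trans (le_max_left _ _),
    fun t ht ↦ ?_⟩
  have ht9 : 9 ≤ t := (le_max_left _ _).trans ht
  have htZ : 3 * ‖riemannZeta (2 : ℝ)‖ ≤ t := (le_max_right _ _).trans ht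
  set A : ℂ := (2 : ℝ) + t * I with hA
  have hAre : A.re = 2 := by simp [hA]
  have hAim : A.im = t := by simp [hA]
  have hre : ∀ z ∈ Metric.ball A (5 / 4), 3 / 4 ≤ z.re := by
    intro z hz
    have h := (Complex.abs_re_le_norm (z - A)).trans (mem_ball_iff_norm.mp hz).le
    rw [Complex.sub_re, hAre] at h
    linarith [(abs_le.mp h).1]
  have him : ∀ z ∈ Metric.ball A (5 / 4), 1 ≤ ‖z - 1‖ := by
    intro z hz
    have h := (Complex.abs_im_le_norm (z - A)).trans (mem_ball_iff_norm.mp hz).le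
    rw [Complex.sub_im, hAim] at h
    have h2 := (le_abs_self _).trans (Complex.abs_im_le_norm (z - 1))
    rw [Complex.sub_im, Complex.one_im] at h2
    linarith [(abs_le.mp h).1]
  have hne1 : ∀ z ∈ Metric.ball A (5 / 4), z ≠ 1 := by
    rintro z hz rfl
    have := him _ hz
    norm_num at this
  have hne0 : ∀ z ∈ Metric.ball A (5 / 4), riemannZeta z ≠ 0 := by
    intro z hz h0
    have h := hRH z h0 ?_ (hne1 z hz)
    · linarith [hre z hz]
    · rintro ⟨n, rfl⟩
      have := hre _ hz
      simp at this
      have hn : (0 : ℝ) ≤ n := n.cast_nonneg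
      linarith
  obtain ⟨L, hL0, hL, hLe⟩ := exists_log_on_ball (by norm_num)
    (fun z hz ↦ (differentiableAt_riemannZeta (hne1 z hz)).differentiableWithinAt) hne0
  have hAmem : A ∈ Metric.ball A (5 / 4) := Metric.mem_ball_self (by norm_num)
  have hlog : 0 < Real.log t := Real.log_pos (by linarith)
  have hReL : ∀ z ∈ Metric.ball A (5 / 4), (L z).re ≤ 2 * Real.log t := by
    intro z hz
    have hz1 : ‖riemannZeta z‖ ≤ 3 * t := by
      have h1 := norm_riemannZeta_sub_le (s := z) (by linarith [hre z hz]) (hne1 z hz)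
      have h2 : ‖1 / (z - 1)‖ ≤ 1 := by
        rw [norm_div, norm_one]
        exact div_le_one_of_le₀ (him z hz) (norm_nonneg _)
      have h3 : ‖z‖ ≤ 5 / 4 + (2 + t) := by
        have h4 : ‖A‖ ≤ 2 + t := by
          refine (norm_add_le _ _).trans ?_
          rw [norm_mul, Complex.norm_I, Complex.norm_real, Complex.norm_real, mul_one,
            Real.norm_of_nonneg (by norm_num), Real.norm_of_nonneg (by linarith)]
        have h5 := norm_add_le (z - A) A
        rw [sub_add_cancel] at h5
        linarith [(mem_ball_iff_norm.mp hz).le]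
      have h6 := norm_add_le (riemannZeta z - 1 / (z - 1)) (1 / (z - 1))
      rw [sub_add_cancel] at h6
      linarith
    have h7 : ‖riemannZeta A‖⁻¹ ≤ ‖riemannZeta (2 : ℝ)‖ := inv_norm_riemannZeta_le (by norm_num) t
    have h8 : Real.exp (L z).re = ‖riemannZeta z‖ * ‖riemannZeta A‖⁻¹ := by
      rw [hLe z hz, norm_mul, Complex.norm_exp]
      have : ‖riemannZeta A‖ ≠ 0 := norm_ne_zero_iff.mpr (hne0 A hAmem)
      field_simp
    have h9 : Real.exp (L z).re ≤ t ^ 2 := by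
      rw [h8]
      calc _ ≤ 3 * t * ‖riemannZeta (2 : ℝ)‖ := by gcongr
        _ ≤ t ^ 2 := by nlinarith
    have h10 := Real.log_le_log (Real.exp_pos _) h9
    rwa [Real.log_exp, Real.log_pow, Nat.cast_ofNat] at h10
  refine ⟨L, hL, hLe, fun z hz ↦ ?_⟩
  have hmem : ∀ w ∈ Metric.ball (0 : ℂ) (5 / 4), A + w ∈ Metric.ball A (5 / 4) := by
    intro w hw
    rwa [mem_ball_iff_norm, add_sub_cancel_left, ← mem_ball_zero_iff]
  have hBC := Complex.borelCaratheodory_zero (f := fun w ↦ L (A + w)) (M := 2 * Real.log t)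
    (R := 5 / 4) (z := z - A) (by positivity) ?_ ?_ (by norm_num) ?_ ?_
  · rw [add_sub_cancel] at hBC
    refine hBC.trans ?_
    rw [div_le_iff₀ (by linarith)]
    nlinarith
  · intro w hw
    have h1 := (hL _ (hmem w hw)).differentiableAt
    exact (h1.comp w (by fun_prop : DifferentiableAt ℂ (fun w ↦ A + w) w)).differentiableWithinAt
  · exact fun w hw ↦ hReL _ (hmem w hw)
  · rw [mem_ball_zero_iff]
    linarith
  · simpa using hL0

/-- Under the Riemann hypothesis, `1 / ζ` on the line `Re s = 1` is controlled by its value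
slightly to the right of that line, at distance as small as `2 / log log t`. -/
lemma RiemannHypothesis.exists_inv_norm_riemannZeta_le (hRH : RiemannHypothesis) :
    ∃ K t₀ : ℝ, 0 < K ∧ ∀ t : ℝ, t₀ ≤ t → ∀ η : ℝ, 0 < η → η ≤ 1 / 16 →
      Real.log t ≤ Real.exp (2 / η) →
      ‖riemannZeta (1 + t * I)‖⁻¹ ≤ K * ‖riemannZeta ((1 + η : ℝ) + t * I)‖⁻¹ := by
  obtain ⟨t₀, ht₀, h⟩ := hRH.exists_log_riemannZeta
  obtain ⟨K, hK, hKb⟩ := exists_norm_deriv_riemannZeta_div_le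
  refine ⟨Real.exp (K * (152 * Real.exp 20)), t₀, Real.exp_pos _, fun t ht η hη hη1 hlt ↦ ?_⟩
  obtain ⟨L, hL, hLe, hLb⟩ := h t ht
  have hlog : 0 < Real.log t := Real.log_pos (by linarith)
  set A : ℂ := (2 : ℝ) + t * I with hA
  have hηn : ‖(η : ℂ)‖ = η := by rw [Complex.norm_real, Real.norm_of_nonneg hη.le]
  have hshift : ∀ z : ℂ, ‖z + η - A‖ ≤ ‖z - A‖ + η := by
    intro z
    have := norm_add_le (z - A) η
    rwa [hηn, sub_add_eq_add_sub] at this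
  set D : ℂ → ℂ := fun z ↦ L (z + η) - L z with hD
  have hDd : ∀ w ∈ Metric.closedBall A (9 / 8), DifferentiableAt ℂ D w := by
    intro w hw
    rw [mem_closedBall_iff_norm] at hw
    have h1 : w ∈ Metric.ball A (5 / 4) := by rw [mem_ball_iff_norm]; linarith
    have h2 : w + η ∈ Metric.ball A (5 / 4) := by rw [mem_ball_iff_norm]; linarith [hshift w]
    have h3 : DifferentiableAt ℂ (fun w : ℂ ↦ w + η) w := by fun_prop
    exact ((hL _ h2).differentiableAt.comp w h3).sub (hL _ h1).differentiableAt
  have hout : ∀ w, ‖w - A‖ = 9 / 8 → ‖D w‖ ≤ 152 * Real.log t := by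
    intro w hw
    have h1 := hLb w (by linarith)
    have h2 := hLb (w + η) (by linarith [hshift w])
    linarith [norm_sub_le (L (w + η)) (L w)]
  have hin : ∀ w, ‖w - A‖ = 1 - η → ‖D w‖ ≤ K := by
    intro w hw
    have hconv : Convex ℝ ({z : ℂ | 1 + η ≤ z.re} ∩ Metric.ball A (5 / 4)) :=
      (convex_halfSpace_re_ge _).inter (convex_ball _ _)
    have hwre : 1 + η ≤ w.re := by
      have h1 := (Complex.abs_re_le_norm (w - A)).trans hw.le
      rw [Complex.sub_re, show A.re = 2 by simp [hA]] at h1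
      linarith [(abs_le.mp h1).1]
    have h2 := hconv.norm_image_sub_le_of_norm_hasDerivWithin_le (f := L)
      (f' := fun z ↦ deriv riemannZeta z / riemannZeta z) (C := K / η) (x := w) (y := w + η)
      (fun z hz ↦ (hL z hz.2).hasDerivWithinAt) (fun z hz ↦ hKb η hη (by linarith) z hz.1)
      ⟨hwre, by rw [mem_ball_iff_norm]; linarith⟩
      ⟨by simp only [Set.mem_ofPred_eq, Complex.add_re, Complex.ofReal_re]; linarith,
        by rw [mem_ball_iff_norm]; linarith [hshift w]⟩
    rwa [add_sub_cancel_left, hηn, div_mul_cancel₀ _ hη.ne'] at h2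
  have hs : (1 + t * I : ℂ) - A = -1 := by rw [hA]; push_cast; ring
  have hs1 : ‖(1 + t * I : ℂ) - A‖ = 1 := by rw [hs, norm_neg, norm_one]
  have h3 := norm_le_interp_of_mem_annulus (z := 1 + t * I) (by linarith : 0 < 1 - η)
    (by linarith : 1 - η < 9 / 8) hDd hin hout (by linarith) (by linarith)
  rw [hs1, Real.log_one, zero_sub] at h3
  set θ := -Real.log (1 - η) / (Real.log (9 / 8) - Real.log (1 - η)) with hθ
  have hl1 : 0 ≤ -Real.log (1 - η) := by
    linarith [Real.log_nonpos (by linarith : 0 ≤ 1 - η) (by linarith)]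
  have hl2 : -Real.log (1 - η) ≤ 16 / 15 * η := by
    have := Real.one_sub_inv_le_log_of_pos (by linarith : 0 < 1 - η)
    have h4 : (1 - η)⁻¹ ≤ 1 + 16 / 15 * η := by
      rw [inv_le_comm₀ (by linarith) (by positivity), inv_le_iff_one_le_mul₀ (by positivity)]
      nlinarith
    linarith
  have hl3 : 1 / 9 ≤ Real.log (9 / 8) := by
    have := Real.one_sub_inv_le_log_of_pos (by norm_num : (0 : ℝ) < 9 / 8)
    norm_num at this ⊢
    linarith
  have hθ0 : 0 ≤ θ := div_nonneg hl1 (by linarith)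
  have hθ1 : θ ≤ 10 * η := by
    rw [hθ, div_le_iff₀ (by linarith)]
    nlinarith
  have hDle : ‖D (1 + t * I)‖ ≤ K * (152 * Real.exp 20) := by
    refine h3.trans (mul_le_mul ?_ ?_ (by positivity) (by linarith))
    · exact (Real.rpow_le_rpow_of_exponent_le hK (by linarith)).trans_eq (Real.rpow_one K)
    · rw [Real.mul_rpow (by norm_num) hlog.le]
      refine mul_le_mul ?_ ?_ (by positivity) (by norm_num)
      · exact (Real.rpow_le_rpow_of_exponent_le (by norm_num) (by linarith)).trans_eq
          (Real.rpow_one _)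
      · refine (Real.rpow_le_rpow hlog.le hlt hθ0).trans ?_
        rw [← Real.exp_mul, Real.exp_le_exp, div_mul_eq_mul_div, div_le_iff₀ hη]
        linarith
  have hm1 : (1 + t * I : ℂ) ∈ Metric.ball A (5 / 4) := by
    rw [mem_ball_iff_norm, hs1]; norm_num
  have hm2 : (1 + t * I : ℂ) + η ∈ Metric.ball A (5 / 4) := by
    rw [mem_ball_iff_norm]; linarith [hshift (1 + t * I)]
  have heq : riemannZeta ((1 + η : ℝ) + t * I) =
      riemannZeta (1 + t * I) * cexp (D (1 + t * I)) := by
    rw [show (((1 + η : ℝ) : ℂ) + t * I) = 1 + t * I + η by push_cast; ring, hLe _ hm2, hLe _ hm1,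
      mul_assoc, ← Complex.exp_add, hD]
    simp
  have hle : ‖riemannZeta ((1 + η : ℝ) + t * I)‖ ≤
      ‖riemannZeta (1 + t * I)‖ * Real.exp (K * (152 * Real.exp 20)) := by
    rw [heq, norm_mul, Complex.norm_exp]
    gcongr
    exact (Complex.re_le_norm _).trans hDle
  have hp1 : 0 < ‖riemannZeta (1 + t * I)‖ :=
    norm_pos_iff.mpr (riemannZeta_ne_zero_of_one_le_re (by simp))
  have hp2 : 0 < ‖riemannZeta ((1 + η : ℝ) + t * I)‖ :=
    norm_pos_iff.mpr (riemannZeta_ne_zero_of_one_le_re (by simp; linarith))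
  rw [← div_eq_mul_inv, inv_eq_one_div, div_le_div_iff₀ hp1 hp2]
  linarith

lemma continuousOn_inv_norm_riemannZeta_vertical {σ : ℝ} (hσ : 1 ≤ σ) {s : Set ℝ}
    (hs : ∀ t ∈ s, 0 < t) : ContinuousOn (fun t : ℝ ↦ ‖riemannZeta (σ + t * I)‖⁻¹) s := by
  intro t ht
  have hne : (σ + t * I : ℂ) ≠ 1 := by
    intro h
    have := congrArg Complex.im h
    simp at this
    exact (hs t ht).ne' this
  have h0 : riemannZeta (σ + t * I) ≠ 0 := riemannZeta_ne_zero_of_one_le_re (by simpa using hσ)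
  have h1 : ContinuousAt (fun t : ℝ ↦ riemannZeta (σ + t * I)) t :=
    ContinuousAt.comp (f := fun t : ℝ ↦ (σ + t * I : ℂ))
      (differentiableAt_riemannZeta hne).continuousAt (by fun_prop)
  exact (h1.norm.inv₀ (norm_ne_zero_iff.mpr h0)).continuousWithinAt

open ProbabilityTheory in
/-- A short integral of `1 / |ζ|` at distance `η` to the right of the line `Re s = 1` is
`O(log (1 / η))`, uniformly in the height. -/
lemma exists_intervalIntegral_inv_norm_riemannZeta_le {δ : ℝ} (hδ : 0 < δ) :
    ∃ K, 0 < K ∧ ∀ η, 0 < η → η ≤ 1 → 1 ≤ Real.log η⁻¹ → ∀ T : ℝ,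
      ∫ u in (0 : ℝ)..δ, ‖riemannZeta ((1 + η : ℝ) + (T + u : ℝ) * I)‖⁻¹ ≤ K * Real.log η⁻¹ := by
  obtain ⟨K, hK, h⟩ := exists_integral_gaussianReal_norm_riemannZeta_le
  refine ⟨√(2 * π) * Real.exp (δ ^ 2 / 2) * (K + 4), by positivity, fun η hη hη1 hl T ↦ ?_⟩
  have hσ : 1 < 1 + η := by linarith
  have hcont : Continuous fun u : ℝ ↦ ‖riemannZeta ((1 + η : ℝ) + (T + u : ℝ) * I)‖⁻¹ := by
    have h0 : ∀ u : ℝ, riemannZeta ((1 + η : ℝ) + (T + u : ℝ) * I) ≠ 0 := fun u ↦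
      riemannZeta_ne_zero_of_one_le_re (by simp; linarith)
    refine Continuous.inv₀ ?_ fun u ↦ norm_ne_zero_iff.mpr (h0 u)
    refine Continuous.norm <| continuous_iff_continuousAt.mpr fun u ↦ ?_
    have hne : ((1 + η : ℝ) + (T + u : ℝ) * I : ℂ) ≠ 1 := by
      intro h
      have := congrArg Complex.re h
      simp at this
      linarith
    exact ContinuousAt.comp (f := fun u : ℝ ↦ ((1 + η : ℝ) + (T + u : ℝ) * I : ℂ))
      (differentiableAt_riemannZeta hne).continuousAt (by fun_prop)
  have hint : Integrable (fun u : ℝ ↦ ‖riemannZeta ((1 + η : ℝ) + (T + u : ℝ) * I)‖⁻¹)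
      (gaussianReal 0 1) := by
    refine Integrable.of_bound hcont.aestronglyMeasurable ‖riemannZeta (1 + η : ℝ)‖
      (ae_of_all _ fun u ↦ ?_)
    rw [norm_inv, norm_norm]
    exact inv_norm_riemannZeta_le hσ _
  calc _ ≤ √(2 * π) * Real.exp (δ ^ 2 / 2) * _ :=
        intervalIntegral_le_mul_integral_gaussianReal (fun u ↦ by positivity) hint hδ
    _ ≤ √(2 * π) * Real.exp (δ ^ 2 / 2) * (K + 4 * Real.log η⁻¹) := by
        gcongr
        exact (integral_gaussianReal_inv_norm_riemannZeta_le hσ T).trans (h η hη hη1)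
    _ ≤ _ := by
        rw [mul_assoc _ (K + 4)]
        gcongr
        nlinarith

theorem stmt_9 (hRH : RiemannHypothesis) (δ : ℝ) (hδ : 0 < δ) :
    ∃ C > (0 : ℝ), ∃ T₀ : ℝ, (16 : ℝ) ≤ T₀ ∧ ∀ T : ℝ, T₀ ≤ T →
      (∫ t in T..(T + δ), ‖riemannZeta (1 + t * Complex.I)‖ ^ ((-1 : ℝ))) ≤ C * Real.log (Real.log (Real.log T)) := by
  obtain ⟨K₁, t₀, hK₁, hRHb⟩ := hRH.exists_inv_norm_riemannZeta_le
  obtain ⟨K₂, hK₂, hmean⟩ := exists_intervalIntegral_inv_norm_riemannZeta_le hδ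
  refine ⟨K₁ * K₂, by positivity, max (max 16 t₀) (max δ (Real.exp (Real.exp 16))),
    (le_max_left _ _).trans (le_max_left _ _), fun T hT ↦ ?_⟩
  simp only [max_le_iff] at hT
  obtain ⟨⟨hT16, hTt⟩, hTδ, hTe⟩ := hT
  have hT0 : 0 < T := by linarith
  have hl1 : Real.exp 16 ≤ Real.log T := (Real.le_log_iff_exp_le hT0).mpr hTe
  have hl1p : 0 < Real.log T := (Real.exp_pos _).trans_le hl1
  have hl2 : 16 ≤ Real.log (Real.log T) := (Real.le_log_iff_exp_le hl1p).mpr hl1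
  have hl2p : 0 < Real.log (Real.log T) := by linarith
  have hl3 : 1 ≤ Real.log (Real.log (Real.log T)) := by
    rw [Real.le_log_iff_exp_le hl2p]
    linarith [Real.exp_one_lt_d9]
  set η := (Real.log (Real.log T))⁻¹ with hη
  have hηp : 0 < η := inv_pos.mpr hl2p
  have hη1 : η ≤ 1 / 16 := by
    rw [hη, one_div]
    exact inv_anti₀ (by norm_num) hl2
  have hηi : η⁻¹ = Real.log (Real.log T) := inv_inv _
  have hheight : ∀ t ∈ Set.Icc T (T + δ), Real.log t ≤ Real.exp (2 / η) := by
    intro t ht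
    have h1 : Real.log t ≤ 2 * Real.log T := by
      rw [← Nat.cast_ofNat (R := ℝ) (n := 2), ← Real.log_pow]
      exact Real.log_le_log (hT0.trans_le ht.1) (by nlinarith [ht.2])
    have h2 : Real.exp (2 / η) = Real.log T ^ 2 := by
      rw [div_eq_mul_inv, hηi, mul_comm, Real.exp_mul, Real.exp_log hl1p]
      norm_cast
    rw [h2]
    nlinarith [Real.add_one_le_exp 16]
  have hpos : ∀ t ∈ Set.uIcc T (T + δ), 0 < t := by
    intro t ht
    rw [Set.uIcc_of_le (by linarith)] at ht
    exact hT0.trans_le ht.1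
  have hc1 := (continuousOn_inv_norm_riemannZeta_vertical le_rfl
    hpos).intervalIntegrable (μ := volume)
  have hc2 := (continuousOn_inv_norm_riemannZeta_vertical (by linarith : 1 ≤ 1 + η)
    hpos).intervalIntegrable (μ := volume)
  rw [ofReal_one] at hc1
  calc ∫ t in T..(T + δ), ‖riemannZeta (1 + t * Complex.I)‖ ^ (-1 : ℝ)
      = ∫ t in T..(T + δ), ‖riemannZeta (1 + t * I)‖⁻¹ := by simp only [Real.rpow_neg_one]
    _ ≤ ∫ t in T..(T + δ), K₁ * ‖riemannZeta ((1 + η : ℝ) + t * I)‖⁻¹ :=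
        integral_mono_on (by linarith) hc1 (hc2.const_mul K₁) fun t ht ↦
          hRHb t (hTt.trans ht.1) η hηp hη1 (hheight t ht)
    _ = K₁ * ∫ u in (0 : ℝ)..δ, ‖riemannZeta ((1 + η : ℝ) + (T + u : ℝ) * I)‖⁻¹ := by
        rw [intervalIntegral.integral_const_mul, integral_comp_add_left
          (fun t : ℝ ↦ ‖riemannZeta ((1 + η : ℝ) + (t : ℝ) * I)‖⁻¹), add_zero]
    _ ≤ K₁ * (K₂ * Real.log η⁻¹) := by
        gcongr
        exact hmean η hηp (by linarith) (by rwa [hηi]) T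
    _ = K₁ * K₂ * Real.log (Real.log (Real.log T)) := by rw [hηi, mul_assoc]
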